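/- Let n ≥ 2, let K be a field, let G = C_{2n}(1,n) be the circulant graph on 2n vertices with connection set {1,n}, and let S = K[V(G)]. Then depth(S/I(G)) = ⌈n/2⌉ if n ≡ 1 (mod 4), and depth(S/I(G)) = ⌈(n−1)/2⌉ otherwise. -/

import Mathlib

open MvPolynomial

/-- The edge ideal of a simple graph `G`, inside `K[x_v : v ∈ V]`. -/
noncomputable def edgeIdeal (K : Type*) [Field K] {V : Type*} (G : SimpleGraph V) :
    Ideal (MvPolynomial V K) :=
  Ideal.span {m | ∃ i j : V, G.Adj i j ∧ m = X i * X j}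

/-- The graded maximal ideal of `K[x_v : v ∈ V]`. -/
noncomputable def maxIdeal (K : Type*) [Field K] (V : Type*) : Ideal (MvPolynomial V K) :=
  Ideal.span (Set.range (X : V → MvPolynomial V K))

/-- depth of `S/I` over `S = K[x_v]`: the supremum of lengths of regular sequences on `S/I`
consisting of elements of the graded maximal ideal. -/
noncomputable def depthQuot {K : Type*} [Field K] {V : Type*} (I : Ideal (MvPolynomial V K)) : ℕ :=
  sSup {n : ℕ | ∃ rs : List (MvPolynomial V K), rs.length = n ∧
    (∀ r ∈ rs, r ∈ maxIdeal K V) ∧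
    RingTheory.Sequence.IsRegular (MvPolynomial V K ⧸ I) rs}

/-- The Stanley space `u·K[Z]` inside `S/I`, as a `K`-subspace. -/
noncomputable def stanleySpace {K : Type*} [Field K] {V : Type*}
    (I : Ideal (MvPolynomial V K)) (u : V →₀ ℕ) (Z : Finset V) :
    Submodule K (MvPolynomial V K ⧸ I) :=
  Submodule.span K
    {x | ∃ a : V →₀ ℕ, a.support ⊆ Z ∧ x = Ideal.Quotient.mk I (monomial (u + a) (1 : K))}

/-- A Stanley decomposition of `S/I`: a finite family of Stanley spaces `u_j K[Z_j]`,
each of which is a free `K[Z_j]`-module (expressed by linear independence of the monomial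
spanning set), whose internal direct sum is all of `S/I`. -/
structure StanleyDecomposition {K : Type*} [Field K] {V : Type*}
    (I : Ideal (MvPolynomial V K)) : Type _ where
  m : ℕ
  u : Fin m → (V →₀ ℕ)
  Z : Fin m → Finset V
  free : ∀ j : Fin m, LinearIndependent K
    (fun a : {a : V →₀ ℕ // a.support ⊆ Z j} =>
      Ideal.Quotient.mk I (monomial (u j + (a : V →₀ ℕ)) (1 : K)))
  internal : DirectSum.IsInternal (fun j : Fin m => stanleySpace I (u j) (Z j))

/-- The Stanley depth of `S/I`. -/
noncomputable def sdepthQuot {K : Type*} [Field K] {V : Type*}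
    (I : Ideal (MvPolynomial V K)) : ℕ :=
  sSup {n : ℕ | ∃ D : StanleyDecomposition I, ∀ j, n ≤ (D.Z j).card}

/-- `pdimLE R n M`: the `R`-module `M` has projective dimension at most `n`,
i.e. it admits a projective resolution of length `n`. -/
def pdimLE (R : Type*) [CommRing R] :
    (n : ℕ) → (M : Type*) → [AddCommGroup M] → [Module R M] → Prop
  | 0, M, _, _ => Module.Projective R M
  | (n+1), M, _, _ => ∃ (P : Type _) (_ : AddCommGroup P) (_ : Module R P)
      (f : P →ₗ[R] M), Module.Projective R P ∧ Function.Surjective f ∧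
        pdimLE R n (LinearMap.ker f)

/-- The projective dimension of `S/I` over `S`: the length of a minimal (projective/free)
resolution, i.e. the least `n` such that `S/I` has a projective resolution of length `n`. -/
noncomputable def pdimQuot {K : Type*} [Field K] {V : Type*}
    (I : Ideal (MvPolynomial V K)) : ℕ :=
  sInf {n : ℕ | pdimLE (MvPolynomial V K) n (MvPolynomial V K ⧸ I)}

/-- The ladder graph `A n` on `2n` vertices: `inl i = x_{i+1}`, `inr i = y_{i+1}`. -/
def graphA (n : ℕ) : SimpleGraph (Fin n ⊕ Fin n) :=
  SimpleGraph.fromRel (fun a b =>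
    match a, b with
    | .inl i, .inl j => (i : ℕ) + 1 = j
    | .inr i, .inr j => (i : ℕ) + 1 = j
    | .inl i, .inr j => (i : ℕ) = (j : ℕ)
    | .inr _, .inl _ => False)

/-- The graph `B n`: the ladder `A n` with one extra vertex `y_{n+1}` and edge `{y_n, y_{n+1}}`.
Here `inl i = x_{i+1}` (`i < n`) and `inr i = y_{i+1}` (`i < n+1`). -/
def graphB (n : ℕ) : SimpleGraph (Fin n ⊕ Fin (n+1)) :=
  SimpleGraph.fromRel (fun a b =>
    match a, b with
    | .inl i, .inl j => (i : ℕ) + 1 = j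
    | .inr i, .inr j => (i : ℕ) + 1 = j
    | .inl i, .inr j => (i : ℕ) = (j : ℕ)
    | .inr _, .inl _ => False)

/-- The graph `C n`: the ladder `A n` with two extra vertices `y_{n+1}, y_{n+2}` and extra
edges `{y_n, y_{n+1}}` and `{y_1, y_{n+2}}`. Here `inl i = x_{i+1}` (`i < n`) and
`inr i = y_{i+1}` (`i < n+2`). -/
def graphC (n : ℕ) : SimpleGraph (Fin n ⊕ Fin (n+2)) :=
  SimpleGraph.fromRel (fun a b =>
    match a, b with
    | .inl i, .inl j => (i : ℕ) + 1 = j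
    | .inr i, .inr j => ((i : ℕ) + 1 = j ∧ (j : ℕ) ≤ n) ∨ ((i : ℕ) = 0 ∧ (j : ℕ) = n + 1)
    | .inl i, .inr j => (i : ℕ) = (j : ℕ)
    | .inr _, .inl _ => False)

/-- The graph `D n`: the ladder `A n` with two extra vertices `x_{n+1}, y_{n+1}` and extra
edges `{y_n, y_{n+1}}` and `{x_1, x_{n+1}}`. Here `inl i = x_{i+1}` and `inr i = y_{i+1}`
(`i < n+1`). -/
def graphD (n : ℕ) : SimpleGraph (Fin (n+1) ⊕ Fin (n+1)) :=
  SimpleGraph.fromRel (fun a b =>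
    match a, b with
    | .inl i, .inl j => ((i : ℕ) + 1 = j ∧ (j : ℕ) ≤ n - 1) ∨ ((i : ℕ) = 0 ∧ (j : ℕ) = n)
    | .inr i, .inr j => (i : ℕ) + 1 = j
    | .inl i, .inr j => (i : ℕ) = (j : ℕ) ∧ (i : ℕ) ≤ n - 1
    | .inr _, .inl _ => False)

/-- The circulant graph `C_q(s)` on vertex set `{x_1, …, x_q}` (realized as `Fin q`):
`x_i` and `x_j` are adjacent iff `|i - j| ∈ s` or `q - |i - j| ∈ s`. -/
def circulantGraph (q : ℕ) (s : Set ℕ) : SimpleGraph (Fin q) :=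
  SimpleGraph.fromRel (fun i j =>
    ((i : ℤ) - (j : ℤ)).natAbs ∈ s ∨ q - ((i : ℤ) - (j : ℤ)).natAbs ∈ s)


section ExtDepth

open CategoryTheory CategoryTheory.Abelian

universe u

variable {R : Type u} [CommRing R] (N : Type u) [AddCommGroup N] [Module R N]

/-- Vanishing of `Ext^i(N, M)`. -/
def ExtZ (R : Type u) [CommRing R] (N : Type u) [AddCommGroup N] [Module R N]
    (M : Type u) [AddCommGroup M] [Module R M] (i : ℕ) : Prop :=
  Subsingleton (Ext (ModuleCat.of R N) (ModuleCat.of R M) i)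

/-- `N`-depth of `M` at least `d`. -/
def DGe (R : Type u) [CommRing R] (N : Type u) [AddCommGroup N] [Module R N]
    (M : Type u) [AddCommGroup M] [Module R M] (d : ℕ) : Prop :=
  ∀ i < d, ExtZ R N M i

/-- `N`-depth of `M` equal to `d`. -/
def DEq (R : Type u) [CommRing R] (N : Type u) [AddCommGroup N] [Module R N]
    (M : Type u) [AddCommGroup M] [Module R M] (d : ℕ) : Prop :=
  DGe R N M d ∧ ¬ ExtZ R N M d

variable {A B C : Type u} [AddCommGroup A] [AddCommGroup B] [AddCommGroup C]
  [Module R A] [Module R B] [Module R C]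

lemma ses_shortExact (f : A →ₗ[R] B) (g : B →ₗ[R] C) (hf : Function.Injective f)
    (hfg : Function.Exact f g) (hg : Function.Surjective g) :
    (ShortComplex.mk (ModuleCat.ofHom f) (ModuleCat.ofHom g)
      (by ext x; exact hfg.apply_apply_eq_zero x)).ShortExact := by
  have := (ModuleCat.mono_iff_injective (ModuleCat.ofHom f)).2 hf
  have := (ModuleCat.epi_iff_surjective (ModuleCat.ofHom g)).2 hg
  refine ShortComplex.ShortExact.mk ?_
  rw [ShortComplex.ShortExact.moduleCat_exact_iff_function_exact]
  exact hfg

variable {N} {f : A →ₗ[R] B} {g : B →ₗ[R] C}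

lemma extZ_mid (hf : Function.Injective f)
    (hfg : Function.Exact f g) (hg : Function.Surjective g) {i : ℕ}
    (hA : ExtZ R N A i) (hC : ExtZ R N C i) : ExtZ R N B i := by
  have hS := ses_shortExact f g hf hfg hg
  refine subsingleton_of_forall_eq 0 fun x => ?_
  obtain ⟨y, rfl⟩ := Ext.covariant_sequence_exact₂ _ hS x (hC.elim _ _)
  rw [show y = 0 from hA.elim _ _]
  simp

lemma extZ_right (hf : Function.Injective f)
    (hfg : Function.Exact f g) (hg : Function.Surjective g) {i : ℕ}
    (hB : ExtZ R N B i) (hA : ExtZ R N A (i + 1)) : ExtZ R N C i := by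
  have hS := ses_shortExact f g hf hfg hg
  refine subsingleton_of_forall_eq 0 fun x => ?_
  obtain ⟨y, rfl⟩ := Ext.covariant_sequence_exact₃ _ hS x rfl (hA.elim _ _)
  rw [show y = 0 from hB.elim _ _]
  simp

lemma extZ_left (hf : Function.Injective f)
    (hfg : Function.Exact f g) (hg : Function.Surjective g) {i : ℕ}
    (hC : ExtZ R N C i) (hB : ExtZ R N B (i + 1)) : ExtZ R N A (i + 1) := by
  have hS := ses_shortExact f g hf hfg hg
  refine subsingleton_of_forall_eq 0 fun x => ?_
  obtain ⟨y, rfl⟩ := Ext.covariant_sequence_exact₁ _ hS x (hB.elim _ _) rfl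
  rw [show y = 0 from hC.elim _ _]
  simp

lemma extZ_left_zero (hf : Function.Injective f) (hB : ExtZ R N B 0) : ExtZ R N A 0 := by
  have := (ModuleCat.mono_iff_injective (ModuleCat.ofHom f)).2 hf
  have h := Ext.postcomp_mk₀_injective_of_mono (ModuleCat.of R N) (ModuleCat.ofHom f)
  exact ⟨fun x y => h (hB.elim _ _)⟩

lemma extZ_congr (e : A ≃ₗ[R] B) {i : ℕ} (h : ExtZ R N A i) : ExtZ R N B i := by
  refine extZ_mid (f := e.toLinearMap) (g := (0 : B →ₗ[R] PUnit.{u+1})) e.injective ?_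
    (fun x => ⟨0, rfl⟩) h ?_
  · intro x; simp
  · refine subsingleton_of_forall_eq 0 fun x => ?_
    have : Limits.IsZero (ModuleCat.of R PUnit.{u+1}) := ModuleCat.isZero_of_subsingleton _
    have h0 : (𝟙 (ModuleCat.of R PUnit.{u+1})) = 0 := this.eq_of_src _ _
    rw [← Ext.comp_mk₀_id x, h0]; simp

lemma DGe.mono {a b : ℕ} (h : DGe R N A a) (hab : b ≤ a) : DGe R N A b :=
  fun i hi => h i (by omega)

lemma DGe.congr (e : A ≃ₗ[R] B) {d : ℕ} (h : DGe R N A d) : DGe R N B d :=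
  fun i hi => extZ_congr e (h i hi)

lemma DEq.congr (e : A ≃ₗ[R] B) {d : ℕ} (h : DEq R N A d) : DEq R N B d :=
  ⟨h.1.congr e, fun h' => h.2 (extZ_congr e.symm h')⟩

lemma DGe.mid (hf : Function.Injective f)
    (hfg : Function.Exact f g) (hg : Function.Surjective g) {d : ℕ}
    (hA : DGe R N A d) (hC : DGe R N C d) : DGe R N B d :=
  fun i hi => extZ_mid hf hfg hg (hA i hi) (hC i hi)

lemma DEq.mid_of_left (hf : Function.Injective f)
    (hfg : Function.Exact f g) (hg : Function.Surjective g) {d : ℕ}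
    (hA : DEq R N A d) (hC : DGe R N C d) : DEq R N B d := by
  refine ⟨hA.1.mid hf hfg hg hC, fun h => hA.2 ?_⟩
  cases d with
  | zero => exact extZ_left_zero hf h
  | succ d => exact extZ_left hf hfg hg (hC d (by omega)) h

lemma DEq.mid_of_right (hf : Function.Injective f)
    (hfg : Function.Exact f g) (hg : Function.Surjective g) {d : ℕ}
    (hC : DEq R N C d) (hA : DGe R N A (d + 2)) : DEq R N B d := by
  refine ⟨(hA.mono (by omega)).mid hf hfg hg hC.1, fun h => hC.2 ?_⟩
  exact extZ_right hf hfg hg h (hA _ (by omega))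

lemma DEq.left (hf : Function.Injective f)
    (hfg : Function.Exact f g) (hg : Function.Surjective g) {d : ℕ}
    (hC : DEq R N C d) (hB : DGe R N B (d + 1)) : DEq R N A (d + 1) := by
  refine ⟨fun i hi => ?_, fun h => hC.2 (extZ_right hf hfg hg (hB d (by omega)) h)⟩
  cases i with
  | zero => exact extZ_left_zero hf (hB 0 (by omega))
  | succ i => exact extZ_left hf hfg hg (hC.1 i (by omega)) (hB _ hi)

lemma DGe.prod {d : ℕ} (hA : DGe R N A d) (hB : DGe R N B d) : DGe R N (A × B) d :=
  hA.mid (f := LinearMap.inl R A B) (g := LinearMap.snd R A B) LinearMap.inl_injective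
    (by intro x; simp [Prod.ext_iff, eq_comm]) LinearMap.snd_surjective hB

lemma DGe.of_regular {x : R} {g : B →ₗ[R] C} (hx : x ∈ Module.annihilator R N)
    (hf : Function.Injective (x • (LinearMap.id : B →ₗ[R] B)))
    (hfg : Function.Exact (x • (LinearMap.id : B →ₗ[R] B)) g) (hg : Function.Surjective g)
    {d : ℕ} (hC : DGe R N C d) : DGe R N B (d + 1) := by
  have hS := ses_shortExact _ g hf hfg hg
  intro i hi
  refine subsingleton_of_forall_eq 0 fun y => ?_
  have h0 : y.comp (Ext.mk₀ (ModuleCat.ofHom (x • (LinearMap.id : B →ₗ[R] B)))) (add_zero i) = 0 := by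
    have h1 := Ext.postcomp_smul_id_eq_zero_of_mem_annihilator (M := ModuleCat.of R B)
      (N := ModuleCat.of R N) hx i
    exact congr($(h1).hom y)
  cases i with
  | zero =>
    have := (ModuleCat.mono_iff_injective
      (ModuleCat.ofHom (x • (LinearMap.id : B →ₗ[R] B)))).2 hf
    have h := Ext.postcomp_mk₀_injective_of_mono (ModuleCat.of R N)
      (ModuleCat.ofHom (x • (LinearMap.id : B →ₗ[R] B)))
    apply h
    simpa using h0
  | succ i =>
    obtain ⟨z, rfl⟩ := Ext.covariant_sequence_exact₁ _ hS y h0 rfl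
    rw [show z = 0 from (hC i (by omega)).elim _ _]
    simp

lemma DEq.of_regular {x : R} {g : B →ₗ[R] C} (hx : x ∈ Module.annihilator R N)
    (hf : Function.Injective (x • (LinearMap.id : B →ₗ[R] B)))
    (hfg : Function.Exact (x • (LinearMap.id : B →ₗ[R] B)) g) (hg : Function.Surjective g)
    {d : ℕ} (hC : DEq R N C d) : DEq R N B (d + 1) :=
  hC.left hf hfg hg (hC.1.of_regular hx hf hfg hg)

lemma DEq.self [Nontrivial N] : DEq R N N 0 := by
  refine ⟨fun i hi => by omega, fun h => ?_⟩
  have h1 : Subsingleton (ModuleCat.of R N ⟶ ModuleCat.of R N) :=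
    Ext.addEquiv₀.subsingleton_congr.mp h
  have h2 : Subsingleton (N →ₗ[R] N) := 
    (ModuleCat.homAddEquiv (M := ModuleCat.of R N) (N := ModuleCat.of R N)).symm.subsingleton
  exact not_subsingleton N ⟨fun a b => congr($(h2.elim LinearMap.id 0) a).trans
    congr($(h2.elim LinearMap.id 0) b).symm⟩

end ExtDepth

section Monomial

universe u

variable (K : Type u) [Field K] {V : Type} (G : SimpleGraph V)

/-- `m` is a nonzero monomial of `S/J(W)`: its support is an independent subset of `W`. -/
def Good (W : Set V) (m : V →₀ ℕ) : Prop :=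
  (∀ v, m v ≠ 0 → v ∈ W) ∧ ∀ i j, m i ≠ 0 → m j ≠ 0 → ¬ G.Adj i j

/-- The ideal generated by the edges inside `W` and the variables outside `W`. -/
noncomputable def JI (W : Set V) : Ideal (MvPolynomial V K) :=
  restrictSupportIdeal K {m | ¬ Good G W m} (by
    intro a b hab ha hb
    apply ha
    have h : ∀ v, a v ≠ 0 → b v ≠ 0 := fun v hv => by have := hab v; omega
    exact ⟨fun v hv => hb.1 v (h v hv), fun i j hi hj => hb.2 i j (h i hi) (h j hj)⟩)

variable {K G}

lemma mem_JI {W : Set V} {f : MvPolynomial V K} :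
    f ∈ JI K G W ↔ ∀ m, Good G W m → f.coeff m = 0 := by
  have e : f ∈ JI K G W ↔ (f.support : Set (V →₀ ℕ)) ⊆ {m | ¬ Good G W m} :=
    mem_restrictSupport_iff K
  rw [e]
  constructor
  · intro h m hm
    by_contra h0
    exact h (Finset.mem_coe.2 (mem_support_iff.2 h0)) hm
  · intro h m hm hg
    exact mem_support_iff.1 (Finset.mem_coe.1 hm) (h m hg)

lemma edgeIdeal_eq : edgeIdeal K G = JI K G Set.univ := by
  classical
  apply le_antisymm
  · rw [edgeIdeal, Ideal.span_le]
    rintro _ ⟨i, j, hij, rfl⟩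
    rw [SetLike.mem_coe, mem_JI]
    intro m hm
    rw [X, X, monomial_mul, coeff_monomial, if_neg]
    rintro rfl
    exact hm.2 i j (by simp) (by simp) hij
  · intro f hf
    rw [mem_JI] at hf
    rw [f.as_sum]
    refine Ideal.sum_mem _ fun m hm => ?_
    have hg : ¬ Good G Set.univ m := fun h => (mem_support_iff.1 hm) (hf m h)
    simp only [Good, Set.mem_univ, implies_true, true_and] at hg
    push Not at hg
    obtain ⟨i, j, hi, hj, hij⟩ := hg
    have hne : i ≠ j := hij.ne
    have hle : Finsupp.single i 1 + Finsupp.single j 1 ≤ m := by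
      intro v
      simp only [Finsupp.add_apply, Finsupp.single_apply]
      split_ifs <;> subst_vars <;> first | omega | exact absurd rfl hne
    obtain ⟨c, hc⟩ := le_iff_exists_add.mp hle
    have : monomial m (f.coeff m) = monomial c (f.coeff m) * (X i * X j) := by
      rw [X, X, monomial_mul, monomial_mul, hc]; simp [add_comm]
    rw [this]
    exact Ideal.mul_mem_left _ _ (Ideal.subset_span ⟨i, j, hij, rfl⟩)

lemma maxIdeal_eq : maxIdeal K V = JI K G ∅ := by
  classical
  apply le_antisymm
  · rw [maxIdeal, Ideal.span_le]
    rintro _ ⟨i, rfl⟩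
    rw [SetLike.mem_coe, mem_JI]
    intro m hm
    rw [X, coeff_monomial, if_neg]
    rintro rfl
    exact hm.1 i (by simp)
  · intro f hf
    rw [mem_JI] at hf
    rw [f.as_sum]
    refine Ideal.sum_mem _ fun m hm => ?_
    have hg : ¬ Good G ∅ m := fun h => (mem_support_iff.1 hm) (hf m h)
    have : ∃ i, m i ≠ 0 := by
      by_contra hh
      push Not at hh
      exact hg ⟨fun v hv => (hv (hh v)).elim, fun i j hi => (hi (hh i)).elim⟩
    obtain ⟨i, hi⟩ := this
    have hle : Finsupp.single i 1 ≤ m := by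
      intro v
      simp only [Finsupp.single_apply]
      split_ifs <;> subst_vars <;> omega
    obtain ⟨c, hc⟩ := le_iff_exists_add.mp hle
    have : monomial m (f.coeff m) = monomial c (f.coeff m) * X i := by
      rw [X, monomial_mul, hc]; simp [add_comm]
    rw [this]
    exact Ideal.mul_mem_left _ _ (Ideal.subset_span ⟨i, rfl⟩)

lemma JI_anti {W W' : Set V} (h : W' ⊆ W) : JI K G W ≤ JI K G W' := by
  intro f hf
  rw [mem_JI] at hf ⊢
  exact fun m hm => hf m ⟨fun v hv => h (hm.1 v hv), hm.2⟩

lemma good_add {W : Set V} {v : V} (hv : v ∈ W) (m : V →₀ ℕ) :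
    Good G W (m + Finsupp.single v 1) ↔ Good G (W \ G.neighborSet v) m := by
  classical
  have key : ∀ w, (m + Finsupp.single v 1 : V →₀ ℕ) w ≠ 0 ↔ m w ≠ 0 ∨ w = v := by
    intro w
    simp only [Finsupp.add_apply, Finsupp.single_apply]
    split_ifs with h
    · subst h; simp
    · have : w ≠ v := fun h' => h h'.symm
      simp [this]
  simp only [Good, key, Set.mem_sdiff, SimpleGraph.mem_neighborSet]
  constructor
  · rintro ⟨h1, h2⟩
    exact ⟨fun w hw => ⟨h1 w (.inl hw), h2 v w (.inr rfl) (.inl hw)⟩,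
      fun i j hi hj => h2 i j (.inl hi) (.inl hj)⟩
  · rintro ⟨h1, h2⟩
    refine ⟨?_, ?_⟩
    · rintro w (hw | rfl)
      exacts [(h1 w hw).1, hv]
    · rintro i j (hi | rfl) (hj | rfl)
      · exact h2 i j hi hj
      · exact fun h => (h1 i hi).2 h.symm
      · exact (h1 j hj).2
      · exact G.irrefl

lemma mul_X_mem {W : Set V} {v : V} (hv : v ∈ W) (f : MvPolynomial V K) :
    X v * f ∈ JI K G W ↔ f ∈ JI K G (W \ G.neighborSet v) := by
  classical
  rw [mem_JI, mem_JI]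
  constructor
  · intro h m hm
    have := h _ ((good_add hv m).2 hm)
    rwa [mul_comm, coeff_mul_X] at this
  · intro h m hm
    rw [mul_comm, coeff_mul_X']
    split_ifs with hs
    · apply h
      rw [← good_add hv]
      convert hm
      ext w
      simp only [Finsupp.add_apply, Finsupp.tsub_apply, Finsupp.single_apply]
      have := Finsupp.mem_support_iff.1 hs
      split_ifs <;> subst_vars <;> omega
    · rfl

lemma mem_JI_del {W : Set V} {v : V} (f : MvPolynomial V K) :
    f ∈ JI K G (W \ {v}) ↔ ∃ g, f - X v * g ∈ JI K G W := by
  classical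
  constructor
  · intro hf
    refine ⟨f.divMonomial (Finsupp.single v 1), ?_⟩
    have e : f - X v * (f.divMonomial (Finsupp.single v 1)) = f.modMonomial (Finsupp.single v 1) := by
      rw [sub_eq_iff_eq_add, modMonomial_add_divMonomial_single]
    rw [e, mem_JI]
    intro m hm
    rw [mem_JI] at hf
    by_cases hle : Finsupp.single v 1 ≤ m
    · exact coeff_modMonomial_of_le _ hle
    · rw [coeff_modMonomial_of_not_le _ hle]
      have hv : m v = 0 := by
        by_contra h
        apply hle
        intro w
        simp only [Finsupp.single_apply]
        split_ifs <;> subst_vars <;> omega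
      refine hf m ⟨fun w hw => ⟨hm.1 w hw, ?_⟩, hm.2⟩
      rintro rfl
      exact hw hv
  · rintro ⟨g, hg⟩
    have h1 := JI_anti (Set.sdiff_subset (t := {v})) hg
    have h2 : X v * g ∈ JI K G (W \ {v}) := by
      rw [mem_JI]
      intro m hm
      rw [mul_comm, coeff_mul_X', if_neg]
      intro hs
      exact (hm.1 v (Finsupp.mem_support_iff.1 hs)).2 rfl
    simpa using Ideal.add_mem _ h1 h2

variable (K G)

/-- the quotient module -/
abbrev MQ (W : Set V) : Type u := MvPolynomial V K ⧸ JI K G W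

/-- depth at least -/
def ge (W : Set V) (d : ℕ) : Prop := DGe (MvPolynomial V K) (MQ K G ∅) (MQ K G W) d

/-- depth equal -/
def eqd (W : Set V) (d : ℕ) : Prop := DEq (MvPolynomial V K) (MQ K G ∅) (MQ K G W) d

/-- deletion map -/
noncomputable def delMap {W W' : Set V} (h : W' ⊆ W) :
    MQ K G W →ₗ[MvPolynomial V K] MQ K G W' := Submodule.factor (JI_anti h)

/-- multiplication map -/
noncomputable def mulMap (W : Set V) (v : V) (hv : v ∈ W) :
    MQ K G (W \ G.neighborSet v) →ₗ[MvPolynomial V K] MQ K G W :=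
  Submodule.mapQ _ _ (LinearMap.mulLeft (MvPolynomial V K) (X v))
    (fun f hf => (mul_X_mem hv f).2 hf)

variable {K G}

lemma delMap_mk {W W' : Set V} (h : W' ⊆ W) (f : MvPolynomial V K) :
    delMap K G h (Submodule.Quotient.mk f) = Submodule.Quotient.mk f := rfl

lemma mulMap_mk {W : Set V} {v : V} (hv : v ∈ W) (f : MvPolynomial V K) :
    mulMap K G W v hv (Submodule.Quotient.mk f) = Submodule.Quotient.mk (X v * f) := rfl

lemma mulMap_injective {W : Set V} {v : V} (hv : v ∈ W) :
    Function.Injective (mulMap K G W v hv) := by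
  rw [injective_iff_map_eq_zero]
  intro a
  obtain ⟨f, rfl⟩ := Submodule.Quotient.mk_surjective _ a
  intro h
  rw [mulMap_mk, Submodule.Quotient.mk_eq_zero] at h
  rw [Submodule.Quotient.mk_eq_zero]
  exact (mul_X_mem hv f).1 h

lemma delMap_surjective {W W' : Set V} (h : W' ⊆ W) : Function.Surjective (delMap K G h) :=
  Submodule.factor_surjective (JI_anti h)

lemma mul_del_exact {W : Set V} {v : V} (hv : v ∈ W) :
    Function.Exact (mulMap K G W v hv) (delMap K G (Set.sdiff_subset : W \ {v} ⊆ W)) := by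
  intro a
  obtain ⟨f, rfl⟩ := Submodule.Quotient.mk_surjective _ a
  rw [delMap_mk, Submodule.Quotient.mk_eq_zero, mem_JI_del]
  constructor
  · rintro ⟨g, hg⟩
    refine ⟨Submodule.Quotient.mk g, ?_⟩
    rw [mulMap_mk]
    exact ((Submodule.Quotient.eq _).2 hg).symm
  · rintro ⟨b, hb⟩
    obtain ⟨g, rfl⟩ := Submodule.Quotient.mk_surjective _ b
    rw [mulMap_mk] at hb
    exact ⟨g, (Submodule.Quotient.eq _).1 hb.symm⟩

lemma ge.mono {W : Set V} {a b : ℕ} (h : ge K G W a) (hab : b ≤ a) : ge K G W b :=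
  DGe.mono h hab

lemma eqd_empty : eqd K G ∅ 0 := by
  have : Nontrivial (MQ K G ∅) := by
    apply Submodule.Quotient.nontrivial_iff.mpr
    rw [Ideal.ne_top_iff_one, mem_JI]
    intro h
    have := h 0 ⟨fun v hv => (hv rfl).elim, fun i j hi => (hi rfl).elim⟩
    simp at this
  exact DEq.self

lemma X_ann (v : V) : (X v : MvPolynomial V K) ∈ Module.annihilator (MvPolynomial V K) (MQ K G ∅) := by
  rw [Ideal.annihilator_quotient, ← maxIdeal_eq]
  exact Ideal.subset_span ⟨v, rfl⟩

lemma isolated_aux {W : Set V} {v : V} (hv : v ∈ W) (h : W \ G.neighborSet v = W) :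
    Function.Injective ((X v : MvPolynomial V K) • (LinearMap.id : MQ K G W →ₗ[MvPolynomial V K] _)) ∧
    Function.Exact ((X v : MvPolynomial V K) • (LinearMap.id : MQ K G W →ₗ[MvPolynomial V K] _))
      (delMap K G (Set.sdiff_subset : W \ {v} ⊆ W)) := by
  have h2 := mul_del_exact (K := K) (G := G) hv
  constructor
  · rw [injective_iff_map_eq_zero]
    intro a
    obtain ⟨f, rfl⟩ := Submodule.Quotient.mk_surjective _ a
    intro hf
    rw [LinearMap.smul_apply, LinearMap.id_apply, ← Submodule.Quotient.mk_smul,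
      Submodule.Quotient.mk_eq_zero, smul_eq_mul, mul_X_mem hv, h] at hf
    exact (Submodule.Quotient.mk_eq_zero _).2 hf
  · intro a
    rw [h2 a]
    constructor
    · rintro ⟨b, rfl⟩
      obtain ⟨g, rfl⟩ := Submodule.Quotient.mk_surjective _ b
      exact ⟨Submodule.Quotient.mk g, rfl⟩
    · rintro ⟨b, rfl⟩
      obtain ⟨g, rfl⟩ := Submodule.Quotient.mk_surjective _ b
      exact ⟨Submodule.Quotient.mk g, rfl⟩

lemma ge.isolated {W : Set V} {v : V} {d : ℕ} (hv : v ∈ W) (h : W \ G.neighborSet v = W)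
    (hd : ge K G (W \ {v}) d) : ge K G W (d + 1) :=
  DGe.of_regular (X_ann v) (isolated_aux hv h).1 (isolated_aux hv h).2 (delMap_surjective _) hd

lemma eqd.isolated {W : Set V} {v : V} {d : ℕ} (hv : v ∈ W) (h : W \ G.neighborSet v = W)
    (hd : eqd K G (W \ {v}) d) : eqd K G W (d + 1) :=
  DEq.of_regular (X_ann v) (isolated_aux hv h).1 (isolated_aux hv h).2 (delMap_surjective _) hd

lemma nbr_aux {W : Set V} {v : V} (hv : v ∈ W) : v ∈ W \ G.neighborSet v ∧
    (W \ G.neighborSet v) \ G.neighborSet v = W \ G.neighborSet v :=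
  ⟨⟨hv, by simp⟩, by ext; simp⟩

lemma ge.step {W : Set V} {v : V} {d : ℕ} (hv : v ∈ W)
    (h1 : ge K G ((W \ G.neighborSet v) \ {v}) d) (h2 : ge K G (W \ {v}) (d + 1)) :
    ge K G W (d + 1) :=
  DGe.mid (mulMap_injective hv) (mul_del_exact hv) (delMap_surjective _)
    (ge.isolated (nbr_aux hv).1 (nbr_aux hv).2 h1) h2

lemma eqd.step_left {W : Set V} {v : V} {d : ℕ} (hv : v ∈ W)
    (h1 : eqd K G ((W \ G.neighborSet v) \ {v}) d) (h2 : ge K G (W \ {v}) (d + 1)) :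
    eqd K G W (d + 1) :=
  DEq.mid_of_left (mulMap_injective hv) (mul_del_exact hv) (delMap_surjective _)
    (eqd.isolated (nbr_aux hv).1 (nbr_aux hv).2 h1) h2

lemma eqd.step_right {W : Set V} {v : V} {d : ℕ} (hv : v ∈ W)
    (h1 : ge K G ((W \ G.neighborSet v) \ {v}) (d + 1)) (h2 : eqd K G (W \ {v}) d) :
    eqd K G W d :=
  DEq.mid_of_right (mulMap_injective hv) (mul_del_exact hv) (delMap_surjective _)
    h2 (ge.isolated (nbr_aux hv).1 (nbr_aux hv).2 h1)

/-- Mayer-Vietoris for two completely joined sets of vertices. -/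
lemma eqd.mayer {W A B : Set V} {d : ℕ} (hAB : ∀ a ∈ A, ∀ b ∈ B, G.Adj a b)
    (h0 : eqd K G (W \ (A ∪ B)) d) (h1 : ge K G (W \ A) (d + 1)) (h2 : ge K G (W \ B) (d + 1)) :
    eqd K G W (d + 1) := by
  classical
  have sA : W \ (A ∪ B) ⊆ W \ A := fun x hx => ⟨hx.1, fun h => hx.2 (.inl h)⟩
  have sB : W \ (A ∪ B) ⊆ W \ B := fun x hx => ⟨hx.1, fun h => hx.2 (.inr h)⟩
  have key : ∀ f : MvPolynomial V K, f ∈ JI K G (W \ (A ∪ B)) →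
      ∃ p ∈ JI K G (W \ A), ∃ q ∈ JI K G (W \ B), f = p + q := by
    intro f hf
    suffices f ∈ JI K G (W \ A) ⊔ JI K G (W \ B) by
      obtain ⟨p, hp, q, hq, e⟩ := Submodule.mem_sup.1 this
      exact ⟨p, hp, q, hq, e.symm⟩
    rw [mem_JI] at hf
    rw [f.as_sum]
    refine Ideal.sum_mem _ fun m hm => ?_
    have hg : ¬ Good G (W \ (A ∪ B)) m := fun h => (mem_support_iff.1 hm) (hf m h)
    have : ¬ Good G (W \ A) m ∨ ¬ Good G (W \ B) m := by
      by_contra hh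
      push Not at hh
      apply hg
      refine ⟨fun v hv => ⟨(hh.1.1 v hv).1, ?_⟩, hh.1.2⟩
      rintro (h | h)
      exacts [(hh.1.1 v hv).2 h, (hh.2.1 v hv).2 h]
    rcases this with h | h
    · refine Ideal.mem_sup_left (mem_JI.2 fun m' hm' => ?_)
      rw [coeff_monomial, if_neg]
      rintro rfl; exact h hm'
    · refine Ideal.mem_sup_right (mem_JI.2 fun m' hm' => ?_)
      rw [coeff_monomial, if_neg]
      rintro rfl; exact h hm'
  let f := (delMap K G (Set.sdiff_subset : W \ A ⊆ W)).prod
    (delMap K G (Set.sdiff_subset : W \ B ⊆ W))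
  let g := (delMap K G sA).coprod (- delMap K G sB)
  refine DEq.left (f := f) (g := g) ?_ ?_ ?_ h0 (DGe.prod h1 h2)
  · rw [injective_iff_map_eq_zero]
    intro a
    obtain ⟨p, rfl⟩ := Submodule.Quotient.mk_surjective _ a
    intro hp
    have ha := (Submodule.Quotient.mk_eq_zero _).1 (congrArg Prod.fst hp)
    have hb := (Submodule.Quotient.mk_eq_zero _).1 (congrArg Prod.snd hp)
    rw [Submodule.Quotient.mk_eq_zero]
    rw [mem_JI] at ha hb ⊢
    intro m hm
    by_cases hA : ∃ v ∈ A, m v ≠ 0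
    · obtain ⟨a, ha, hma⟩ := hA
      refine hb m ⟨fun v hv => ⟨hm.1 v hv, fun hvB => ?_⟩, hm.2⟩
      exact hm.2 a v hma hv (hAB a ha v hvB)
    · push Not at hA
      exact ha m ⟨fun v hv => ⟨hm.1 v hv, fun hvA => hv (hA v hvA)⟩, hm.2⟩
  · rintro ⟨a, b⟩
    obtain ⟨p, rfl⟩ := Submodule.Quotient.mk_surjective _ a
    obtain ⟨q, rfl⟩ := Submodule.Quotient.mk_surjective _ b
    simp only [g, LinearMap.coprod_apply, LinearMap.neg_apply, delMap_mk,
      ← sub_eq_add_neg, sub_eq_zero]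
    rw [Submodule.Quotient.eq]
    constructor
    · intro h
      obtain ⟨r, hr, s, hs, e⟩ := key _ h
      refine ⟨Submodule.Quotient.mk (p - r), ?_⟩
      refine Prod.ext ((Submodule.Quotient.eq _).2 ?_) ((Submodule.Quotient.eq _).2 ?_)
      · simpa using hr
      · convert hs using 1
        change p - r - q = s
        linear_combination e
    · rintro ⟨c, hc⟩
      obtain ⟨r, rfl⟩ := Submodule.Quotient.mk_surjective _ c
      have hc1 := (Submodule.Quotient.eq _).1 (congrArg Prod.fst hc)
      have hc2 := (Submodule.Quotient.eq _).1 (congrArg Prod.snd hc)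
      have := Ideal.sub_mem _ (JI_anti sB hc2) (JI_anti sA hc1)
      simpa using this
  · intro c
    obtain ⟨a, rfl⟩ := delMap_surjective sA c
    exact ⟨(a, 0), by simp [g]⟩

/-- The depth computed by regular sequences agrees with the depth computed by `Ext`. -/
lemma depthQuot_of_eqd [Finite V] {d : ℕ} (h : eqd K G Set.univ d) :
    depthQuot (edgeIdeal K G) = d := by
  have e1 : maxIdeal K V = JI K G ∅ := maxIdeal_eq
  rw [depthQuot, edgeIdeal_eq, e1]
  have hlt : JI K G ∅ • (⊤ : Submodule (MvPolynomial V K) (MQ K G Set.univ)) < ⊤ := by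
    rw [lt_top_iff_ne_top]
    intro htop
    have h1 : JI K G ∅ • (⊤ : Submodule (MvPolynomial V K) (MQ K G Set.univ)) ≤
        LinearMap.ker (delMap K G (Set.empty_subset Set.univ)) := by
      rw [Submodule.smul_le]
      intro r hr n _
      rw [LinearMap.mem_ker, map_smul]
      obtain ⟨p, hp⟩ := Submodule.Quotient.mk_surjective _
        (delMap K G (Set.empty_subset Set.univ) n)
      rw [← hp, ← Submodule.Quotient.mk_smul, Submodule.Quotient.mk_eq_zero]
      exact Ideal.mul_mem_right _ _ hr
    rw [htop, top_le_iff, LinearMap.ker_eq_top] at h1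
    have h2 : (1 : MvPolynomial V K) ∈ JI K G ∅ := by
      rw [← Submodule.Quotient.mk_eq_zero, ← delMap_mk (Set.empty_subset Set.univ)]
      exact congr($h1 _)
    rw [mem_JI] at h2
    have := h2 0 ⟨fun v hv => (hv rfl).elim, fun i j hi => (hi rfl).elim⟩
    simp at this
  have supp : Module.support (MvPolynomial V K) (MQ K G ∅) =
      PrimeSpectrum.zeroLocus (JI K G ∅ : Set (MvPolynomial V K)) := by
    rw [Module.support_eq_zeroLocus, Ideal.annihilator_quotient]
  apply IsGreatest.csSup_eq
  constructor
  · exact ModuleCat.exists_isRegular_of_exists_subsingleton_ext (JI K G ∅) d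
      (ModuleCat.of _ (MQ K G Set.univ)) hlt (ModuleCat.of _ (MQ K G ∅)) supp h.1
  · rintro n ⟨rs, rfl, hrs, reg⟩
    by_contra hn
    exact h.2 (ModuleCat.subsingleton_ext_of_exists_isRegular (JI K G ∅)
      (ModuleCat.of _ (MQ K G ∅)) supp.subset (ModuleCat.of _ (MQ K G Set.univ)) hlt rs hrs reg d
      (by omega))

end Monomial

section Ladder

universe u

/-- The infinite ladder. -/
def LAdj (a b : ℕ × Bool) : Prop :=
  (a.2 = b.2 ∧ (a.1 + 1 = b.1 ∨ b.1 + 1 = a.1)) ∨ (a.2 ≠ b.2 ∧ a.1 = b.1)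

variable (K : Type u) [Field K] {V : Type} (G : SimpleGraph V)

/-- `f` embeds the piece `T` of the ladder as an induced subgraph of `G`. -/
def Emb (f : ℕ × Bool → V) (T : Set (ℕ × Bool)) : Prop :=
  ∀ a ∈ T, ∀ b ∈ T, (f a = f b → a = b) ∧ (G.Adj (f a) (f b) ↔ LAdj a b)

/-- depth lower bound for every copy of `T` in `G` -/
def Lge (T : Set (ℕ × Bool)) (d : ℕ) : Prop := ∀ f, Emb G f T → ge K G (f '' T) d

/-- depth value for every copy of `T` in `G` -/
def Leq (T : Set (ℕ × Bool)) (d : ℕ) : Prop := ∀ f, Emb G f T → eqd K G (f '' T) d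

variable {K G}

lemma Emb.mono {f : ℕ × Bool → V} {T T' : Set (ℕ × Bool)} (h : Emb G f T) (hT : T' ⊆ T) :
    Emb G f T' := fun a ha b hb => h a (hT ha) b (hT hb)

lemma ge_zero {W : Set V} : ge K G W 0 := fun i hi => by omega

lemma eqd.toGe {W : Set V} {d : ℕ} (h : eqd K G W d) : ge K G W d := h.1

lemma Leq.toLge {T : Set (ℕ × Bool)} {d e : ℕ} (h : Leq K G T d) (hd : e ≤ d) : Lge K G T e :=
  fun f hf => (h f hf).toGe.mono hd

lemma Emb.del {f : ℕ × Bool → V} {T T' : Set (ℕ × Bool)} (h : Emb G f T) {a : ℕ × Bool}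
    (ha : a ∈ T) (hT : ∀ b, b ∈ T' ↔ b ∈ T ∧ b ≠ a) : f '' T \ {f a} = f '' T' := by
  ext x
  constructor
  · rintro ⟨⟨b, hb, rfl⟩, hx⟩
    exact ⟨b, (hT b).2 ⟨hb, fun e => hx (by rw [e]; rfl)⟩, rfl⟩
  · rintro ⟨b, hb, rfl⟩
    obtain ⟨h1, h2⟩ := (hT b).1 hb
    exact ⟨⟨b, h1, rfl⟩, fun e => h2 ((h b h1 a ha).1 e)⟩

lemma Emb.nbr {f : ℕ × Bool → V} {T T' : Set (ℕ × Bool)} (h : Emb G f T) {a : ℕ × Bool}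
    (ha : a ∈ T) (hT : ∀ b, b ∈ T' ↔ b ∈ T ∧ b ≠ a ∧ ¬ LAdj a b) :
    (f '' T \ G.neighborSet (f a)) \ {f a} = f '' T' := by
  ext x
  constructor
  · rintro ⟨⟨⟨b, hb, rfl⟩, hx⟩, hx'⟩
    refine ⟨b, (hT b).2 ⟨hb, fun e => hx' (by rw [e]; rfl), fun e => hx ?_⟩, rfl⟩
    exact (h a ha b hb).2.2 e
  · rintro ⟨b, hb, rfl⟩
    obtain ⟨h1, h2, h3⟩ := (hT b).1 hb
    exact ⟨⟨⟨b, h1, rfl⟩, fun e => h3 ((h a ha b h1).2.1 e)⟩, fun e => h2 ((h b h1 a ha).1 e)⟩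

lemma Emb.iso {f : ℕ × Bool → V} {T : Set (ℕ × Bool)} (h : Emb G f T) {a : ℕ × Bool}
    (ha : a ∈ T) (hT : ∀ b ∈ T, ¬ LAdj a b) :
    f '' T \ G.neighborSet (f a) = f '' T := by
  ext x
  constructor
  · exact fun hx => hx.1
  · rintro ⟨b, hb, rfl⟩
    exact ⟨⟨b, hb, rfl⟩, fun e => hT b hb ((h a ha b hb).2.1 e)⟩

lemma Lge.isolated {T T' : Set (ℕ × Bool)} {d : ℕ} (a : ℕ × Bool) (ha : a ∈ T)
    (hi : ∀ b ∈ T, ¬ LAdj a b) (hT : ∀ b, b ∈ T' ↔ b ∈ T ∧ b ≠ a) (h : Lge K G T' d) :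
    Lge K G T (d + 1) := by
  intro f hf
  refine ge.isolated (Set.mem_image_of_mem f ha) (hf.iso ha hi) ?_
  rw [hf.del ha hT]
  exact h f (hf.mono fun b hb => ((hT b).1 hb).1)

lemma Leq.isolated {T T' : Set (ℕ × Bool)} {d : ℕ} (a : ℕ × Bool) (ha : a ∈ T)
    (hi : ∀ b ∈ T, ¬ LAdj a b) (hT : ∀ b, b ∈ T' ↔ b ∈ T ∧ b ≠ a) (h : Leq K G T' d) :
    Leq K G T (d + 1) := by
  intro f hf
  refine eqd.isolated (Set.mem_image_of_mem f ha) (hf.iso ha hi) ?_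
  rw [hf.del ha hT]
  exact h f (hf.mono fun b hb => ((hT b).1 hb).1)

lemma Leq.step {T T1 T2 : Set (ℕ × Bool)} {d : ℕ} (a : ℕ × Bool) (ha : a ∈ T)
    (h1 : ∀ b, b ∈ T1 ↔ b ∈ T ∧ b ≠ a ∧ ¬ LAdj a b)
    (h2 : ∀ b, b ∈ T2 ↔ b ∈ T ∧ b ≠ a) (e1 : Leq K G T1 d) (e2 : Lge K G T2 (d + 1)) :
    Leq K G T (d + 1) := by
  intro f hf
  refine eqd.step_left (Set.mem_image_of_mem f ha) ?_ ?_
  · rw [hf.nbr ha h1]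
    exact e1 f (hf.mono fun b hb => ((h1 b).1 hb).1)
  · rw [hf.del ha h2]
    exact e2 f (hf.mono fun b hb => ((h2 b).1 hb).1)

/-- deletion of one vertex and of an isolated vertex, with the closed neighbourhood removed -/
lemma Leq.step' {T T1 T2 : Set (ℕ × Bool)} {d : ℕ} (a c : ℕ × Bool) (ha : a ∈ T) (hc : c ∈ T)
    (hca : c ≠ a) (hiso : ∀ b ∈ T, b ≠ a → ¬ LAdj c b)
    (h1 : ∀ b, b ∈ T1 ↔ b ∈ T ∧ b ≠ a ∧ ¬ LAdj a b)
    (h2 : ∀ b, b ∈ T2 ↔ b ∈ T ∧ b ≠ a ∧ b ≠ c) (e1 : Leq K G T1 d) (e2 : Lge K G T2 d) :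
    Leq K G T (d + 1) := by
  refine Leq.step (T2 := {b | b ∈ T ∧ b ≠ a}) a ha h1 (fun b => Iff.rfl) e1 ?_
  refine Lge.isolated c ⟨hc, hca⟩ (fun b hb => hiso b hb.1 hb.2) (fun b => ?_) e2
  rw [h2]; simp [and_assoc]

lemma Leq_empty : Leq K G ∅ 0 := by
  intro f _
  rw [Set.image_empty]
  exact eqd_empty

/-- full columns `1..m` -/
def TA (m : ℕ) : Set (ℕ × Bool) := {p | 1 ≤ p.1 ∧ p.1 ≤ m}

/-- full columns `1..m` and one more vertex at the end -/
def TB (m : ℕ) (r : Bool) : Set (ℕ × Bool) := {p | (1 ≤ p.1 ∧ p.1 ≤ m) ∨ (p.1 = m + 1 ∧ p.2 = r)}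

/-- full columns `1..m` and one more vertex at each end -/
def TE (m : ℕ) (r : Bool) : Set (ℕ × Bool) :=
  {p | (p.1 = 0 ∧ p.2 = false) ∨ (1 ≤ p.1 ∧ p.1 ≤ m) ∨ (p.1 = m + 1 ∧ p.2 = r)}

lemma mem_TA {m i : ℕ} {s : Bool} : (i, s) ∈ TA m ↔ 1 ≤ i ∧ i ≤ m := Iff.rfl
lemma mem_TB {m i : ℕ} {r s : Bool} : (i, s) ∈ TB m r ↔
  (1 ≤ i ∧ i ≤ m) ∨ (i = m + 1 ∧ s = r) := Iff.rfl
lemma mem_TE {m i : ℕ} {r s : Bool} : (i, s) ∈ TE m r ↔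
  (i = 0 ∧ s = false) ∨ (1 ≤ i ∧ i ≤ m) ∨ (i = m + 1 ∧ s = r) := Iff.rfl
lemma LAdj_mk {i j : ℕ} {r s : Bool} : LAdj (i, r) (j, s) ↔
  (r = s ∧ (i + 1 = j ∨ j + 1 = i)) ∨ (r ≠ s ∧ i = j) := Iff.rfl

lemma Leq_B (m : ℕ) : ∀ r, Leq K G (TB m r) (m / 2 + 1) := by
  induction m using Nat.strong_induction_on with
  | _ m ih =>
  intro r
  rcases m with _ | _ | m
  · refine Leq.isolated (T' := ∅) (1, r) (by simp [mem_TB]) ?_ ?_ Leq_empty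
    · rintro ⟨j, s⟩
      simp only [mem_TB, LAdj_mk]
      cases r <;> cases s <;> simp <;> omega
    · rintro ⟨j, s⟩
      simp only [mem_TB, Set.mem_empty_iff_false, ne_eq, Prod.mk.injEq]
      cases r <;> cases s <;> simp <;> omega
  · refine Leq.step' (T1 := ∅) (T2 := TB 0 (!r)) (1, r) (2, r) (by simp [mem_TB])
      (by simp [mem_TB]) (by simp) ?_ ?_ ?_ Leq_empty ((ih 0 (by omega) _).toLge (by omega))
    all_goals
      rintro ⟨j, s⟩
      simp only [mem_TB, LAdj_mk, Set.mem_empty_iff_false, ne_eq, Prod.mk.injEq]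
      cases r <;> cases s <;> simp <;> omega
  · have e : (m + 1 + 1) / 2 = m / 2 + 1 := by omega
    rw [e]
    refine Leq.step' (T1 := TB m (!r)) (T2 := TB (m + 1) (!r)) (m + 2, r) (m + 3, r)
      (by simp [mem_TB]) (by simp [mem_TB]) (by simp) ?_ ?_ ?_ (ih m (by omega) _)
      ((ih (m + 1) (by omega) _).toLge (by omega))
    all_goals
      rintro ⟨j, s⟩
      simp only [mem_TB, LAdj_mk, Set.mem_empty_iff_false, ne_eq, Prod.mk.injEq]
      cases r <;> cases s <;> simp <;> omega

/-- the depth values of the family `TE` -/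
def lval (m : ℕ) (r : Bool) : ℕ := if r then 2 * (m / 4) + 2 else 2 * ((m + 2) / 4) + 1

lemma Leq_single : Leq K G {(0, false)} 1 := by
  refine Leq.isolated (T' := ∅) (0, false) (by simp) ?_ ?_ Leq_empty
  · rintro ⟨j, s⟩
    simp only [Set.mem_singleton_iff, LAdj_mk, Prod.mk.injEq]
    cases s <;> simp <;> omega
  · rintro ⟨j, s⟩
    simp

lemma Leq_E (m : ℕ) : ∀ r, Leq K G (TE m r) (lval m r) := by
  induction m using Nat.strong_induction_on with
  | _ m ih =>
  intro r
  rcases m with _ | _ | m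
  · cases r
    · refine Leq.step (T1 := ∅) (T2 := {(0, false)}) (1, false) (by simp [mem_TE]) ?_ ?_ Leq_empty
        (Leq_single.toLge (by simp))
      all_goals
        rintro ⟨j, s⟩
        simp only [mem_TE, LAdj_mk, Set.mem_empty_iff_false, Set.mem_singleton_iff, ne_eq,
          Prod.mk.injEq]
        cases s <;> simp <;> omega
    · refine Leq.isolated (T' := {(0, false)}) (1, true) (by simp [mem_TE]) ?_ ?_ Leq_single
      all_goals
        rintro ⟨j, s⟩
        simp only [mem_TE, LAdj_mk, Set.mem_empty_iff_false, Set.mem_singleton_iff, ne_eq,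
          Prod.mk.injEq]
        cases s <;> simp <;> omega
  · cases r
    · refine Leq.step' (T1 := ∅) (T2 := TE 0 true) (1, false) (2, false) (by simp [mem_TE])
        (by simp [mem_TE]) (by simp) ?_ ?_ ?_ Leq_empty ((ih 0 (by omega) _).toLge (by simp [lval]))
      all_goals
        rintro ⟨j, s⟩
        simp only [mem_TE, LAdj_mk, Set.mem_empty_iff_false, Set.mem_singleton_iff, ne_eq,
          Prod.mk.injEq]
        cases s <;> simp <;> omega
    · refine Leq.step' (T1 := {(0, false)}) (T2 := TE 0 false) (1, true) (2, true)
        (by simp [mem_TE])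
        (by simp [mem_TE]) (by simp) ?_ ?_ ?_ Leq_single ((ih 0 (by omega) _).toLge (by simp [lval]))
      all_goals
        rintro ⟨j, s⟩
        simp only [mem_TE, LAdj_mk, Set.mem_empty_iff_false, Set.mem_singleton_iff, ne_eq,
          Prod.mk.injEq]
        cases s <;> simp <;> omega
  · have e : lval (m + 1 + 1) r = lval m (!r) + 1 := by
      cases r <;> simp [lval] <;> omega
    rw [e]
    refine Leq.step' (T1 := TE m (!r)) (T2 := TE (m + 1) (!r)) (m + 2, r) (m + 3, r)
      (by simp [mem_TE]) (by simp [mem_TE]) (by simp) ?_ ?_ ?_ (ih m (by omega) _)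
      ((ih (m + 1) (by omega) _).toLge (by cases r <;> simp [lval] <;> omega))
    all_goals
      rintro ⟨j, s⟩
      simp only [mem_TE, LAdj_mk, Set.mem_empty_iff_false, ne_eq, Prod.mk.injEq]
      cases r <;> cases s <;> simp <;> omega

lemma Emb.image_diff {f : ℕ × Bool → V} {T A : Set (ℕ × Bool)} (h : Emb G f T) (hA : A ⊆ T) :
    f '' T \ f '' A = f '' (T \ A) := by
  ext x
  constructor
  · rintro ⟨⟨b, hb, rfl⟩, hx⟩
    exact ⟨b, ⟨hb, fun hbA => hx ⟨b, hbA, rfl⟩⟩, rfl⟩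
  · rintro ⟨b, hb, rfl⟩
    refine ⟨⟨b, hb.1, rfl⟩, ?_⟩
    rintro ⟨c, hc, e⟩
    rw [(h c (hA hc) b hb.1).1 e] at hc
    exact hb.2 hc

lemma Leq.mayer {T A B : Set (ℕ × Bool)} {d : ℕ} (hA : A ⊆ T) (hB : B ⊆ T)
    (hAB : ∀ a ∈ A, ∀ b ∈ B, LAdj a b)
    (h0 : Leq K G (T \ (A ∪ B)) d) (h1 : Lge K G (T \ A) (d + 1)) (h2 : Lge K G (T \ B) (d + 1)) :
    Leq K G T (d + 1) := by
  intro f hf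
  refine eqd.mayer (A := f '' A) (B := f '' B) ?_ ?_ ?_ ?_
  · rintro _ ⟨a, ha, rfl⟩ _ ⟨b, hb, rfl⟩
    exact (hf a (hA ha) b (hB hb)).2.2 (hAB a ha b hb)
  · rw [← Set.image_union, hf.image_diff (Set.union_subset hA hB)]
    exact h0 f (hf.mono Set.sdiff_subset)
  · rw [hf.image_diff hA]
    exact h1 f (hf.mono Set.sdiff_subset)
  · rw [hf.image_diff hB]
    exact h2 f (hf.mono Set.sdiff_subset)

lemma Leq_A (k : ℕ) : Leq K G (TA (2 * k)) k := by
  induction k with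
  | zero =>
    have : TA (2 * 0) = ∅ := by ext ⟨j, s⟩; simp [mem_TA]; omega
    rw [this]; exact Leq_empty
  | succ k ih =>
    have hdel : ∀ r : Bool, Lge K G (TA (2 * (k + 1)) \ {(2 * k + 1, r), (2 * k + 2, !r)}) (k + 1) := by
      intro r
      refine Leq.toLge (d := k + 2) ?_ (by omega)
      have hB := Leq_B (K := K) (G := G) (2 * k) (!r)
      rw [show 2 * k / 2 + 1 = k + 1 by omega] at hB
      refine Leq.isolated (2 * k + 2, r) (by simp [mem_TA]; omega) ?_ ?_ hB
      all_goals
        rintro ⟨j, s⟩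
        simp only [mem_TA, mem_TB, LAdj_mk, Set.mem_sdiff, Set.mem_insert_iff,
          Set.mem_singleton_iff, ne_eq, Prod.mk.injEq]
        cases r <;> cases s <;> simp <;> omega
    refine Leq.mayer (A := {(2 * k + 1, false), (2 * k + 2, true)})
      (B := {(2 * k + 1, true), (2 * k + 2, false)}) ?_ ?_ ?_ ?_ (hdel false) (hdel true)
    · rintro ⟨j, s⟩
      simp only [mem_TA, Set.mem_insert_iff, Set.mem_singleton_iff, Prod.mk.injEq]
      omega
    · rintro ⟨j, s⟩
      simp only [mem_TA, Set.mem_insert_iff, Set.mem_singleton_iff, Prod.mk.injEq]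
      omega
    · rintro a (rfl | rfl) b (rfl | rfl) <;> simp [LAdj_mk]
    · convert ih using 1
      ext ⟨j, s⟩
      simp only [mem_TA, Set.mem_sdiff, Set.mem_union, Set.mem_insert_iff,
          Set.mem_singleton_iff, Prod.mk.injEq]
      cases s <;> simp <;> omega

end Ladder

section Moebius

universe u

variable {K : Type u} [Field K] {n : ℕ}

lemma circ_adj (hn : 2 ≤ n) (i j : Fin (2 * n)) :
    (circulantGraph (2 * n) ({1, n} : Set ℕ)).Adj i j ↔
      ((i : ℕ) + 1 = j ∨ (j : ℕ) + 1 = i ∨ (i : ℕ) + n = j ∨ (j : ℕ) + n = i ∨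
        (i : ℕ) + 1 = j + 2 * n ∨ (j : ℕ) + 1 = i + 2 * n) := by
  simp only [circulantGraph, SimpleGraph.fromRel_adj, Set.mem_insert_iff, Set.mem_singleton_iff,
    ne_eq, Fin.ext_iff]
  have := i.2
  have := j.2
  omega

/-- parametrisation of the Möbius ladder by the ladder -/
def par (n c : ℕ) (hn : 2 ≤ n) (p : ℕ × Bool) : Fin (2 * n) :=
  ⟨if p.1 + c + (if p.2 then n else 0) < 2 * n then p.1 + c + (if p.2 then n else 0)
    else if p.1 + c + (if p.2 then n else 0) < 4 * n then p.1 + c + (if p.2 then n else 0) - 2 * n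
    else 0, by split_ifs <;> omega⟩

lemma par_emb (c : ℕ) (hn : 3 ≤ n) (hc : c ≤ n + 1) {T : Set (ℕ × Bool)}
    (hT : ∀ i r, (i, r) ∈ T → i < n)
    (hT2 : ∀ i j r s, (i, r) ∈ T → (j, s) ∈ T → i + 1 = j + n → r = s) :
    Emb (circulantGraph (2 * n) ({1, n} : Set ℕ)) (par n c (by omega)) T := by
  rintro ⟨i, r⟩ ha ⟨j, s⟩ hb
  have h1 := hT _ _ ha
  have h2 := hT _ _ hb
  have h3 := hT2 _ _ _ _ ha hb
  have h4 := hT2 _ _ _ _ hb ha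
  rw [circ_adj (by omega)]
  simp only [par, LAdj_mk, Fin.ext_iff, Prod.mk.injEq]
  cases r <;> cases s <;>
    simp only [Bool.false_eq_true, reduceCtorEq, if_true, if_false, ne_eq, not_true_eq_false,
      not_false_eq_true, true_and, false_and, and_true, and_false, or_false, false_or, imp_false]
        at * <;>
    split_ifs <;> constructor <;> omega

lemma mem_par (c : ℕ) (hn : 3 ≤ n) (hc : c ≤ n + 1) {T : Set (ℕ × Bool)}
    (hT : ∀ i r, (i, r) ∈ T → i < n) (x : Fin (2 * n)) :
    x ∈ par n c (by omega) '' T ↔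
      (c ≤ x ∧ ((x : ℕ) - c, false) ∈ T) ∨ ((x : ℕ) + 2 * n - c, false) ∈ T ∨
      (c + n ≤ x ∧ ((x : ℕ) - c - n, true) ∈ T) ∨ (c ≤ x + n ∧ ((x : ℕ) + n - c, true) ∈ T) := by
  have hx := x.2
  constructor
  · rintro ⟨⟨i, r⟩, hi, rfl⟩
    have h1 := hT _ _ hi
    have key : ∀ k, k = i → (k, r) ∈ T := by rintro k rfl; exact hi
    cases r
    · by_cases h : i + c < 2 * n
      · left
        simp only [par, Bool.false_eq_true, if_false, add_zero, h, if_true]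
        exact ⟨by omega, key _ (by omega)⟩
      · right; left
        have h' : i + c < 4 * n := by omega
        simp only [par, Bool.false_eq_true, if_false, add_zero, h, if_true, h']
        exact key _ (by omega)
    · right; right
      by_cases h : i + c + n < 2 * n
      · left
        simp only [par, h, if_true]
        exact ⟨by omega, key _ (by omega)⟩
      · right
        have h' : i + c + n < 4 * n := by omega
        simp only [par, if_false, h, if_true, h']
        exact ⟨by omega, key _ (by omega)⟩
  · rintro (⟨h, h'⟩ | h' | ⟨h, h'⟩ | ⟨h, h'⟩) <;>
    · have := hT _ _ h'
      refine ⟨_, h', ?_⟩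
      simp only [par, Fin.ext_iff, Bool.false_eq_true, if_true, if_false]
      split_ifs <;> omega

lemma TE_lt {m : ℕ} {r : Bool} (h : m + 2 ≤ n) : ∀ i s, (i, s) ∈ TE m r → i < n := by
  intro i s
  rw [mem_TE]; omega

lemma TE_emb (c m : ℕ) (hn : 3 ≤ n) (hc : c ≤ n + 1) (r : Bool)
    (h : m + 3 ≤ n ∨ (r = false ∧ m + 2 ≤ n)) :
    Emb (circulantGraph (2 * n) ({1, n} : Set ℕ)) (par n c (by omega)) (TE m r) := by
  refine par_emb c hn hc (TE_lt (by omega)) ?_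
  intro i j r' s'
  simp only [mem_TE]
  intro h1 h2 h3
  rcases h with h | ⟨rfl, h⟩
  · omega
  · have : r' = false := by
      rcases h1 with h1 | h1 | h1
      exacts [h1.2, by omega, h1.2]
    have : s' = false := by
      rcases h2 with h1 | h1 | h1
      exacts [h1.2, by omega, by omega]
    simp_all

lemma TA_emb (c m : ℕ) (hn : 3 ≤ n) (hc : c ≤ n + 1) (h : m + 1 ≤ n) :
    Emb (circulantGraph (2 * n) ({1, n} : Set ℕ)) (par n c (by omega)) (TA m) := by
  refine par_emb c hn hc (fun i s => ?_) ?_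
  · rw [mem_TA]; omega
  · intro i j r' s'
    simp only [mem_TA]
    omega

lemma TB_emb (c m : ℕ) (hn : 3 ≤ n) (hc : c ≤ n + 1) (r : Bool) (h : m + 2 ≤ n) :
    Emb (circulantGraph (2 * n) ({1, n} : Set ℕ)) (par n c (by omega)) (TB m r) := by
  refine par_emb c hn hc (fun i s => ?_) ?_
  · rw [mem_TB]; omega
  · intro i j r' s'
    simp only [mem_TB]
    omega


/-- zero vertex -/
def v0 (n : ℕ) (hn : 3 ≤ n) : Fin (2 * n) := ⟨0, by omega⟩

lemma nbr0 (hn : 3 ≤ n) : (Set.univ \ (circulantGraph (2 * n) ({1, n} : Set ℕ)).neighborSet (v0 n hn)) \ {v0 n hn} =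
    par n (n + 1) (by omega) '' (TE (n - 3) true) := by
  ext x
  rw [mem_par _ hn (by omega) (TE_lt (by omega))]
  have := x.2
  simp only [Set.mem_sdiff, Set.mem_univ, true_and, SimpleGraph.mem_neighborSet,
    circ_adj (show 2 ≤ n by omega), Set.mem_singleton_iff, Fin.ext_iff, mem_TE, v0]
  simp
  omega

lemma nbrU (hn : 3 ≤ n) : ((Set.univ \ {v0 n hn}) \
      (circulantGraph (2 * n) ({1, n} : Set ℕ)).neighborSet ⟨n - 1, by omega⟩) \ {⟨n - 1, by omega⟩} =
    par n 0 (by omega) '' (TB (n - 3) true) := by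
  ext x
  rw [mem_par _ hn (by omega) (by intro i s; rw [mem_TB]; omega)]
  have := x.2
  simp only [Set.mem_sdiff, Set.mem_univ, true_and, SimpleGraph.mem_neighborSet,
    circ_adj (show 2 ≤ n by omega), Set.mem_singleton_iff, Fin.ext_iff, mem_TB, v0]
  simp
  omega

lemma delU (hn : 3 ≤ n) : (Set.univ \ {v0 n hn}) \ {(⟨n - 1, by omega⟩ : Fin (2 * n))} =
    par n n (by omega) '' (TE (n - 2) false) := by
  ext x
  rw [mem_par _ hn (by omega) (TE_lt (by omega))]
  have := x.2
  simp only [Set.mem_sdiff, Set.mem_univ, true_and, Set.mem_singleton_iff, Fin.ext_iff, mem_TE, v0]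
  simp
  omega

lemma nbrW (hn : 3 ≤ n) : ((Set.univ \ {v0 n hn}) \
      (circulantGraph (2 * n) ({1, n} : Set ℕ)).neighborSet ⟨n, by omega⟩) \ {⟨n, by omega⟩} =
    par n 1 (by omega) '' (TE (n - 3) true) := by
  ext x
  rw [mem_par _ hn (by omega) (TE_lt (by omega))]
  have := x.2
  simp only [Set.mem_sdiff, Set.mem_univ, true_and, SimpleGraph.mem_neighborSet,
    circ_adj (show 2 ≤ n by omega), Set.mem_singleton_iff, Fin.ext_iff, mem_TE, v0]
  simp
  omega

lemma delW (hn : 3 ≤ n) : (Set.univ \ {v0 n hn}) \ {(⟨n, by omega⟩ : Fin (2 * n))} =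
    par n 0 (by omega) '' (TA (n - 1)) := by
  ext x
  rw [mem_par _ hn (by omega) (by intro i s; rw [mem_TA]; omega)]
  have := x.2
  simp only [Set.mem_sdiff, Set.mem_univ, true_and, Set.mem_singleton_iff, Fin.ext_iff, mem_TA, v0]
  omega

lemma ge_del0 (hn : 3 ≤ n) (d : ℕ) (h1 : d + 1 ≤ (n - 3) / 2 + 2)
    (h2 : d + 1 ≤ 2 * (n / 4) + 1) : ge K (circulantGraph (2 * n) ({1, n} : Set ℕ)) (Set.univ \ {v0 n hn}) (d + 1) := by
  refine ge.step (v := ⟨n - 1, by omega⟩) ?_ ?_ ?_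
  · simp [v0, Fin.ext_iff]; omega
  · rw [nbrU hn]
    exact ((Leq_B (n - 3) true).toLge (by omega)) _ (TB_emb _ _ hn (by omega) _ (by omega))
  · rw [delU hn]
    refine ((Leq_E (n - 2) false).toLge ?_) _ (TE_emb _ _ hn (by omega) _ (by simp; omega))
    simp [lval]; omega

lemma eqd_12 (hn : 3 ≤ n) (h : n % 4 = 1 ∨ n % 4 = 2) :
    eqd K (circulantGraph (2 * n) ({1, n} : Set ℕ)) Set.univ (2 * ((n - 3) / 4) + 3) := by
  refine eqd.step_left (v := v0 n hn) (Set.mem_univ _) ?_ (ge_del0 hn _ (by omega) (by omega))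
  rw [nbr0 hn]
  exact Leq_E (n - 3) true _ (TE_emb _ _ hn (by omega) _ (by omega))

lemma eqd_3 (hn : 3 ≤ n) (h : n % 4 = 3) :
    eqd K (circulantGraph (2 * n) ({1, n} : Set ℕ)) Set.univ ((n - 1) / 2) := by
  refine eqd.step_right (v := v0 n hn) (Set.mem_univ _) ?_ ?_
  · rw [nbr0 hn]
    refine ((Leq_E (n - 3) true).toLge ?_) _ (TE_emb _ _ hn (by omega) _ (by omega))
    simp [lval]; omega
  · refine eqd.step_right (v := ⟨n, by omega⟩) ?_ ?_ ?_
    · simp [v0, Fin.ext_iff]; omega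
    · rw [nbrW hn]
      refine ((Leq_E (n - 3) true).toLge ?_) _ (TE_emb _ _ hn (by omega) _ (by omega))
      simp [lval]; omega
    · rw [delW hn]
      have := Leq_A (K := K) (G := circulantGraph (2 * n) ({1, n} : Set ℕ)) ((n - 1) / 2)
      rw [show 2 * ((n - 1) / 2) = n - 1 by omega] at this
      exact this _ (TA_emb _ _ hn (by omega) (by omega))

lemma eqd_0 (hn : 3 ≤ n) (h : n % 4 = 0) :
    eqd K (circulantGraph (2 * n) ({1, n} : Set ℕ)) Set.univ ((n - 2) / 2 + 1) := by
  refine eqd.mayer (K := K) (A := {x : Fin (2 * n) | (x : ℕ) = 0 ∨ (x : ℕ) = n + 1}) (B := {x : Fin (2 * n) | (x : ℕ) = n ∨ (x : ℕ) = 1})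
    ?_ ?_ ?_ ?_
  · intro a ha b hb
    simp only [Set.mem_setOf_eq] at ha hb
    rw [circ_adj (by omega)]
    omega
  · have := Leq_A (K := K) (G := circulantGraph (2 * n) ({1, n} : Set ℕ)) ((n - 2) / 2)
    rw [show 2 * ((n - 2) / 2) = n - 2 by omega] at this
    convert this _ (TA_emb 1 _ hn (by omega) (by omega)) using 1
    ext x
    rw [mem_par _ hn (by omega) (by intro i s; rw [mem_TA]; omega)]
    have := x.2
    simp only [Set.mem_sdiff, Set.mem_univ, true_and, Set.mem_union, Set.mem_setOf_eq, mem_TA]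
    omega
  · convert ((Leq_E (K := K) (G := circulantGraph (2 * n) ({1, n} : Set ℕ)) (n - 2) false).toLge (e := (n - 2) / 2 + 1) (by simp [lval]; omega)) _
      (TE_emb 1 _ hn (by omega) _ (by simp; omega)) using 1
    ext x
    rw [mem_par _ hn (by omega) (TE_lt (by omega))]
    have := x.2
    simp only [Set.mem_sdiff, Set.mem_univ, true_and, Set.mem_setOf_eq, mem_TE]
    simp
    omega
  · convert ((Leq_E (K := K) (G := circulantGraph (2 * n) ({1, n} : Set ℕ)) (n - 2) false).toLge (e := (n - 2) / 2 + 1) (by simp [lval]; omega)) _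
      (TE_emb (n + 1) _ hn (by omega) _ (by simp; omega)) using 1
    ext x
    rw [mem_par _ hn (by omega) (TE_lt (by omega))]
    have := x.2
    simp only [Set.mem_sdiff, Set.mem_univ, true_and, Set.mem_setOf_eq, mem_TE]
    simp
    omega

lemma ge_one {V : Type} {G : SimpleGraph V} (s : Finset V) :
    s.Nonempty → ge K G (s : Set V) 1 := by
  classical
  induction s using Finset.strongInduction with
  | _ s ih =>
  rintro ⟨v, hv⟩
  by_cases h : (s.erase v).Nonempty
  · refine ge.step (d := 0) (Finset.mem_coe.2 hv) ge_zero ?_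
    rw [← Finset.coe_erase]
    exact ih _ (Finset.erase_ssubset hv) h
  · refine ge.isolated (d := 0) (Finset.mem_coe.2 hv) ?_ ge_zero
    ext w
    simp only [Set.mem_sdiff, Finset.mem_coe, SimpleGraph.mem_neighborSet, and_iff_left_iff_imp]
    intro hw hadj
    exact h ⟨w, Finset.mem_erase.2 ⟨hadj.ne', hw⟩⟩

lemma eqd_two : eqd K (circulantGraph (2 * 2) ({1, 2} : Set ℕ)) Set.univ 1 := by
  refine eqd.step_left (d := 0) (v := (0 : Fin 4)) (Set.mem_univ _) ?_ ?_
  · convert eqd_empty using 1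
    ext x
    have := x.2
    simp only [Set.mem_sdiff, Set.mem_univ, true_and, SimpleGraph.mem_neighborSet,
      circ_adj (show 2 ≤ 2 by omega), Set.mem_singleton_iff, Fin.ext_iff,
      Set.mem_empty_iff_false]
    simp
    omega
  · convert ge_one (K := K) (Finset.univ.erase (0 : Fin 4)) ⟨1, by decide⟩ using 1
    ext x; simp

end Moebius

theorem depth_circulant_one (n : ℕ) (hn : 2 ≤ n) (K : Type*) [Field K] :
    (n % 4 = 1 → depthQuot (edgeIdeal K (circulantGraph (2 * n) ({1, n} : Set ℕ))) = ⌈(n : ℚ) / 2⌉₊) ∧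
    (n % 4 ≠ 1 → depthQuot (edgeIdeal K (circulantGraph (2 * n) ({1, n} : Set ℕ))) = ⌈((n : ℚ) - 1) / 2⌉₊) := by
  constructor
  · intro h
    rw [depthQuot_of_eqd (eqd_12 (by omega) (.inl h))]
    symm
    rw [Nat.ceil_eq_iff (by omega)]
    obtain ⟨k, rfl⟩ : ∃ k, n = 4 * k + 5 := ⟨(n - 5) / 4, by omega⟩
    rw [show (4 * k + 5 - 3) / 4 = k by omega]
    constructor
    · rw [show 2 * k + 3 - 1 = 2 * k + 2 by omega]; push_cast; linarith
    · push_cast; linarith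
  · intro h
    have key : depthQuot (edgeIdeal K (circulantGraph (2 * n) ({1, n} : Set ℕ))) = n / 2 := by
      by_cases h2 : n = 2
      · subst h2
        exact depthQuot_of_eqd eqd_two
      · have h3 : 3 ≤ n := by omega
        have : n % 4 = 0 ∨ n % 4 = 2 ∨ n % 4 = 3 := by omega
        rcases this with h | h | h
        · rw [depthQuot_of_eqd (eqd_0 h3 h)]; omega
        · rw [depthQuot_of_eqd (eqd_12 h3 (.inr h))]; omega
        · rw [depthQuot_of_eqd (eqd_3 h3 h)]; omega
    rw [key]
    symm
    rw [Nat.ceil_eq_iff (by omega)]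
    obtain ⟨k, hk⟩ : ∃ k, n / 2 = k + 1 := ⟨n / 2 - 1, by omega⟩
    rw [hk]
    have h4 : 2 * k + 2 ≤ n := by omega
    have h5 : n ≤ 2 * k + 3 := by omega
    have h4' : (2 * k + 2 : ℚ) ≤ n := by exact_mod_cast h4
    have h5' : (n : ℚ) ≤ 2 * k + 3 := by exact_mod_cast h5
    constructor
    · rw [show k + 1 - 1 = k by omega]; linarith
    · push_cast; linarith
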